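/- arXiv:2504.12519 — 2 statements merged into one kernel-verified Lean document; each statement's English description precedes it below -/
import Mathlib

section
/- F_U(r) = (1+o(1))·(−c/Γ(−θ))·r^{−θ−1} as r → +∞, where Γ(−θ) denotes the value of the Gamma function at −θ ∈ (−2,−1). -/
open Filter Topology MeasureTheory

/-- `F_U(r) = (1/2π)·∫_{−∞}^{∞} e^{irs}/(c·e^{i·sign(s)·θπ/2}·|s|^θ + 1) ds`
(the real value of the integral, which is real by conjugation symmetry). -/
noncomputable def FUfun (c θ : ℝ) (r : ℝ) : ℝ :=
  ((1 / (2 * Real.pi)) * ∫ s : ℝ,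
    Complex.exp (Complex.I * r * s) /
      ((c : ℂ) * Complex.exp (Complex.I * Real.sign s * θ * Real.pi / 2) *
        ((|s| ^ θ : ℝ) : ℂ) + 1)).re


lemma integrable_exp_abs_aux {κ : ℝ} (hκ : 0 < κ) :
    Integrable (fun x : ℝ => Real.exp (-κ * |x|)) := by
  rw [← integrableOn_univ, ← Set.Iic_union_Ioi (a := (0:ℝ)), integrableOn_union]
  constructor
  · refine (integrableOn_exp_mul_Iic hκ 0).congr_fun (fun x hx => ?_) measurableSet_Iic
    have hx' : x ≤ 0 := hx
    simp only [abs_of_nonpos hx']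
    ring_nf
  · refine (integrableOn_exp_mul_Ioi (neg_lt_zero.mpr hκ) 0).congr_fun (fun x hx => ?_)
      measurableSet_Ioi
    have hx' : 0 < x := hx
    simp only [abs_of_pos hx']

lemma shift_integrable (H : ℂ → ℂ) (y K κ : ℝ) (hκ : 0 < κ)
    (hd : ∀ x : ℝ, DifferentiableAt ℂ H (x + y * Complex.I))
    (hb : ∀ x : ℝ, ‖H (x + y * Complex.I)‖ ≤ K * Real.exp (-κ * |x|)) :
    Integrable (fun x : ℝ => H (x + y * Complex.I)) := by
  refine Integrable.mono' ((integrable_exp_abs_aux hκ).const_mul K) ?_ (ae_of_all _ hb)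
  refine Continuous.aestronglyMeasurable ?_
  rw [continuous_iff_continuousAt]
  intro x
  exact ContinuousAt.comp (f := fun x : ℝ => (x + y * Complex.I : ℂ)) (g := H)
    (hd x).continuousAt (by fun_prop)

lemma shift_vert (H : ℂ → ℂ) (a b K κ : ℝ) (hab : a ≤ b) (hκ : 0 < κ) (u : ℝ → ℝ)
    (hu : Tendsto (fun T => |u T|) atTop atTop)
    (hb : ∀ x y : ℝ, a ≤ y → y ≤ b →
      ‖H (x + y * Complex.I)‖ ≤ K * Real.exp (-κ * |x|)) :
    Tendsto (fun T : ℝ => ∫ y : ℝ in a..b, H (u T + y * Complex.I)) atTop (𝓝 0) := by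
  have h1 : Tendsto (fun T : ℝ => K * Real.exp (-κ * |u T|) * |b - a|) atTop (𝓝 0) := by
    have h2 : Tendsto (fun T : ℝ => -κ * |u T|) atTop atBot :=
      hu.const_mul_atTop_of_neg (neg_lt_zero.mpr hκ)
    simpa using ((Real.tendsto_exp_atBot.comp h2).const_mul K).mul_const (|b - a|)
  refine squeeze_zero_norm (fun T => ?_) h1
  refine intervalIntegral.norm_integral_le_of_norm_le_const (fun y hy => ?_)
  rw [Set.uIoc_of_le hab] at hy
  exact hb _ _ hy.1.le hy.2

lemma shift_integral (H : ℂ → ℂ) (a b K κ : ℝ) (hab : a ≤ b) (hκ : 0 < κ)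
    (hd : ∀ x y : ℝ, a ≤ y → y ≤ b → DifferentiableAt ℂ H (x + y * Complex.I))
    (hb : ∀ x y : ℝ, a ≤ y → y ≤ b →
      ‖H (x + y * Complex.I)‖ ≤ K * Real.exp (-κ * |x|)) :
    ∫ x : ℝ, H (x + a * Complex.I) = ∫ x : ℝ, H (x + b * Complex.I) := by
  have ia := shift_integrable H a K κ hκ (fun x => hd x a le_rfl hab) (fun x => hb x a le_rfl hab)
  have ib := shift_integrable H b K κ hκ (fun x => hd x b hab le_rfl) (fun x => hb x b hab le_rfl)
  have ta := intervalIntegral_tendsto_integral ia tendsto_neg_atTop_atBot tendsto_id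
  have tb := intervalIntegral_tendsto_integral ib tendsto_neg_atTop_atBot tendsto_id
  have v1 := shift_vert H a b K κ hab hκ (fun T => T) tendsto_abs_atTop_atTop hb
  have v2 := shift_vert H a b K κ hab hκ (fun T => -T)
    (by simpa using tendsto_abs_atTop_atTop) hb
  have key := ((ta.sub tb).add (v1.const_smul Complex.I)).sub (v2.const_smul Complex.I)
  have hz : ∀ T : ℝ, ((∫ x : ℝ in -T..id T, H (x + a * Complex.I)) -
      (∫ x : ℝ in -T..id T, H (x + b * Complex.I)) +
      Complex.I • (∫ y : ℝ in a..b, H ((T : ℝ) + y * Complex.I)) -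
      Complex.I • (∫ y : ℝ in a..b, H ((-T : ℝ) + y * Complex.I))) = 0 := by
    intro T
    have := Complex.integral_boundary_rect_eq_zero_of_differentiableOn H
      ⟨-T, a⟩ ⟨T, b⟩ (fun z hz => ?_)
    · simpa using this
    · have h2 := hz.2
      simp only [Set.mem_preimage, Set.uIcc_of_le hab] at h2
      have h3 := hd z.re z.im h2.1 h2.2
      rw [Complex.re_add_im] at h3
      exact h3.differentiableWithinAt
  have k2 := key.congr hz
  have k3 := tendsto_nhds_unique k2 tendsto_const_nhds
  simp only [smul_zero, add_zero, sub_zero] at k3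
  exact sub_eq_zero.mp k3

lemma integral_log_sub (f : ℝ → ℂ) :
    ∫ t in Set.Ioi (0:ℝ), f t = ∫ x : ℝ, (Real.exp x : ℂ) * f (Real.exp x) := by
  have := integral_image_eq_integral_abs_deriv_smul (s := Set.univ) (f := Real.exp)
    (f' := Real.exp) MeasurableSet.univ
    (fun x _ => (Real.hasDerivAt_exp x).hasDerivWithinAt) Real.exp_injective.injOn f
  rw [Set.image_univ, Real.range_exp, setIntegral_univ] at this
  rw [this]
  refine integral_congr_ae (ae_of_all _ fun x => ?_)
  simp [abs_of_pos (Real.exp_pos x)]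

lemma integrableOn_log_sub (f : ℝ → ℂ) :
    IntegrableOn f (Set.Ioi (0:ℝ)) ↔
      Integrable (fun x : ℝ => (Real.exp x : ℂ) * f (Real.exp x)) := by
  have := integrableOn_image_iff_integrableOn_abs_deriv_smul (s := Set.univ) (f := Real.exp)
    (f' := Real.exp) MeasurableSet.univ
    (fun x _ => (Real.hasDerivAt_exp x).hasDerivWithinAt) Real.exp_injective.injOn f
  rw [Set.image_univ, Real.range_exp, integrableOn_univ] at this
  rw [this]
  refine integrable_congr (ae_of_all _ fun x => ?_)
  simp [abs_of_pos (Real.exp_pos x)]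

lemma norm_lower (ρ α δ : ℝ) (hρ : 0 ≤ ρ) (h : δ ≤ Real.sin α) :
    δ ≤ ‖(ρ : ℂ) * Complex.exp (α * Complex.I) + 1‖ ∧
    δ * ρ ≤ ‖(ρ : ℂ) * Complex.exp (α * Complex.I) + 1‖ := by
  constructor
  · have e : (ρ : ℂ) * Complex.exp (α * Complex.I) + 1 =
        Complex.exp (α * Complex.I) * (ρ + Complex.exp ((-α : ℝ) * Complex.I)) := by
      rw [mul_add, ← Complex.exp_add]
      push_cast
      rw [show (α : ℂ) * Complex.I + -α * Complex.I = 0 by ring, Complex.exp_zero]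
      ring
    rw [e, norm_mul, Complex.norm_exp_ofReal_mul_I, one_mul]
    refine le_trans ?_ (Complex.abs_im_le_norm _)
    rw [Complex.add_im, Complex.exp_ofReal_mul_I_im, Complex.ofReal_im, zero_add, Real.sin_neg,
      abs_neg]
    exact h.trans (le_abs_self _)
  · refine le_trans ?_ (Complex.abs_im_le_norm _)
    rw [Complex.add_im, Complex.im_ofReal_mul, Complex.exp_ofReal_mul_I_im, Complex.one_im,
      add_zero, mul_comm δ]
    exact (mul_le_mul_of_nonneg_left h hρ).trans (le_abs_self _)

/-- integrand along the ray of angle `y` -/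
noncomputable def rayFun (c θ r y t : ℝ) : ℂ :=
  Complex.exp (r * t * Complex.exp (y * Complex.I)) * Complex.exp (y * Complex.I) /
    (((c * t ^ θ : ℝ) : ℂ) * Complex.exp (((θ * y : ℝ) : ℂ) * Complex.I) + 1)

/-- the integrand in logarithmic coordinates -/
noncomputable def logFun (c θ r : ℝ) (w : ℂ) : ℂ :=
  Complex.exp (r * Complex.exp w + w) / (c * Complex.exp (θ * w) + 1)

lemma den_eq (c θ x y : ℝ) : (c : ℂ) * Complex.exp (θ * (x + y * Complex.I)) + 1 =
    ((c * Real.exp x ^ θ : ℝ) : ℂ) * Complex.exp (((θ * y : ℝ) : ℂ) * Complex.I) + 1 := by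
  rw [← Real.exp_mul]
  push_cast
  rw [mul_assoc, ← Complex.exp_add]
  ring_nf

lemma logFun_eq (c θ r x y : ℝ) :
    logFun c θ r (x + y * Complex.I) = (Real.exp x : ℂ) * rayFun c θ r y (Real.exp x) := by
  unfold logFun rayFun
  rw [den_eq, Complex.exp_add (_ * _) _, Complex.exp_add (x : ℂ)]
  push_cast
  rw [mul_div_assoc', mul_assoc (r : ℂ)]
  congr 1
  ring

lemma sin_lower (θ φ y : ℝ) (hθ1 : 1 < θ) (hφ2 : θ * φ < Real.pi)
    (hy1 : Real.pi / 2 ≤ y) (hy2 : y ≤ φ) : Real.sin (θ * φ) ≤ Real.sin (θ * y) := by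
  have hp := Real.pi_pos
  rw [← Real.cos_sub_pi_div_two, ← Real.cos_sub_pi_div_two]
  refine Real.cos_le_cos_of_nonneg_of_le_pi ?_ ?_ ?_
  · nlinarith
  · linarith
  · nlinarith

lemma logFun_bound (c θ φ r x y : ℝ) (hc : 0 < c) (hθ1 : 1 < θ) (hθ2 : θ < 2) (hr : 0 ≤ r)
    (hφ1 : Real.pi / 2 ≤ φ) (hφ2 : θ * φ < Real.pi)
    (hy1 : Real.pi / 2 ≤ y) (hy2 : y ≤ φ) :
    DifferentiableAt ℂ (logFun c θ r) (x + y * Complex.I) ∧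
    ‖logFun c θ r (x + y * Complex.I)‖ ≤
      ((1 + 1 / c) / Real.sin (θ * φ)) * Real.exp (-(θ - 1) * |x|) := by
  have hp := Real.pi_pos
  have hs := sin_lower θ φ y hθ1 hφ2 hy1 hy2
  have hδ : 0 < Real.sin (θ * φ) := Real.sin_pos_of_pos_of_lt_pi (by nlinarith) hφ2
  have hφπ : φ < Real.pi := by nlinarith
  obtain ⟨n1, n2⟩ := norm_lower (c * Real.exp x ^ θ) (θ * y) _ (by positivity) hs
  rw [← den_eq] at n1 n2
  set δ := Real.sin (θ * φ)
  have hne : (c : ℂ) * Complex.exp (θ * (x + y * Complex.I)) + 1 ≠ 0 := by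
    rw [← norm_pos_iff]; linarith
  constructor
  · unfold logFun
    refine DifferentiableAt.div (by fun_prop) (by fun_prop) hne
  · unfold logFun
    rw [norm_div, Complex.norm_exp]
    have hre : ((r : ℂ) * Complex.exp (x + y * Complex.I) + (x + y * Complex.I)).re =
        r * (Real.exp x * Real.cos y) + x := by
      simp [Complex.exp_re]
    rw [hre]
    have hcos : Real.cos y ≤ 0 := Real.cos_nonpos_of_pi_div_two_le_of_le hy1 (by linarith)
    have hnum : Real.exp (r * (Real.exp x * Real.cos y) + x) ≤ Real.exp x := by
      rw [Real.exp_le_exp]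
      have : r * (Real.exp x * Real.cos y) ≤ 0 :=
        mul_nonpos_of_nonneg_of_nonpos hr
          (mul_nonpos_of_nonneg_of_nonpos (Real.exp_pos x).le hcos)
      linarith
    have hn0 : 0 < ‖(c : ℂ) * Complex.exp (θ * (x + y * Complex.I)) + 1‖ := norm_pos_iff.mpr hne
    rw [div_le_iff₀ hn0]
    refine hnum.trans ?_
    have hc1 : 0 < 1 / c := by positivity
    have hE := Real.exp_pos (-(θ - 1) * |x|)
    rcases le_total x 0 with hx | hx
    · have h1 : Real.exp x ≤ Real.exp (-(θ - 1) * |x|) := by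
        rw [Real.exp_le_exp, abs_of_nonpos hx]; nlinarith
      calc Real.exp x ≤ Real.exp (-(θ - 1) * |x|) := h1
        _ ≤ (1 + 1 / c) * Real.exp (-(θ - 1) * |x|) := by nlinarith
        _ = ((1 + 1 / c) / δ) * Real.exp (-(θ - 1) * |x|) * δ := by field_simp
        _ ≤ _ := by gcongr
    · have h1 : Real.exp x = Real.exp (-(θ - 1) * |x|) * Real.exp x ^ θ := by
        rw [← Real.exp_mul, ← Real.exp_add, abs_of_nonneg hx]; ring_nf
      calc Real.exp x = (1 / c) * Real.exp (-(θ - 1) * |x|) * (c * Real.exp x ^ θ) := by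
              rw [mul_mul_mul_comm, one_div, inv_mul_cancel₀ hc.ne', one_mul]; exact h1
        _ ≤ (1 + 1 / c) * Real.exp (-(θ - 1) * |x|) * (c * Real.exp x ^ θ) := by
              gcongr; linarith
        _ = ((1 + 1 / c) / δ) * Real.exp (-(θ - 1) * |x|) * (δ * (c * Real.exp x ^ θ)) := by
              field_simp
        _ ≤ _ := by gcongr

lemma ray_rot (c θ φ r : ℝ) (hc : 0 < c) (hθ1 : 1 < θ) (hθ2 : θ < 2) (hr : 0 ≤ r)
    (hφ1 : Real.pi / 2 ≤ φ) (hφ2 : θ * φ < Real.pi) :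
    (∫ t in Set.Ioi (0:ℝ), rayFun c θ r (Real.pi / 2) t) =
      ∫ t in Set.Ioi (0:ℝ), rayFun c θ r φ t := by
  rw [integral_log_sub, integral_log_sub]
  simp only [← logFun_eq]
  exact shift_integral _ _ _ ((1 + 1 / c) / Real.sin (θ * φ)) (θ - 1) hφ1 (by linarith)
    (fun x y h1 h2 => (logFun_bound c θ φ r x y hc hθ1 hθ2 hr hφ1 hφ2 h1 h2).1)
    (fun x y h1 h2 => (logFun_bound c θ φ r x y hc hθ1 hθ2 hr hφ1 hφ2 h1 h2).2)

lemma ray_integrable (c θ φ r y : ℝ) (hc : 0 < c) (hθ1 : 1 < θ) (hθ2 : θ < 2) (hr : 0 ≤ r)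
    (hφ1 : Real.pi / 2 ≤ φ) (hφ2 : θ * φ < Real.pi)
    (hy1 : Real.pi / 2 ≤ y) (hy2 : y ≤ φ) :
    IntegrableOn (rayFun c θ r y) (Set.Ioi 0) := by
  rw [integrableOn_log_sub]
  simp only [← logFun_eq]
  exact shift_integrable _ _ ((1 + 1 / c) / Real.sin (θ * φ)) (θ - 1) (by linarith)
    (fun x => (logFun_bound c θ φ r x y hc hθ1 hθ2 hr hφ1 hφ2 hy1 hy2).1)
    (fun x => (logFun_bound c θ φ r x y hc hθ1 hθ2 hr hφ1 hφ2 hy1 hy2).2)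

/-- Hankel-type integrand along a ray -/
noncomputable def hankFun (θ y t : ℝ) : ℂ :=
  Complex.exp (t * Complex.exp (y * Complex.I)) * ((t ^ θ : ℝ) : ℂ) *
    Complex.exp ((((θ + 1) * y : ℝ) : ℂ) * Complex.I)

lemma hankFun_eq (θ x y : ℝ) :
    Complex.exp (Complex.exp (x + y * Complex.I) + (θ + 1) * (x + y * Complex.I)) =
      (Real.exp x : ℂ) * hankFun θ y (Real.exp x) := by
  unfold hankFun
  rw [← Real.exp_mul]
  push_cast
  rw [← Complex.exp_add, ← Complex.exp_add, ← Complex.exp_add, Complex.exp_add x (y * Complex.I)]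
  ring_nf

lemma hank_bound (θ φ x y : ℝ) (hθ1 : 1 < θ) (hθ2 : θ < 2)
    (hφ1 : Real.pi / 2 < φ) (hy1 : φ ≤ y) (hy2 : y ≤ Real.pi) :
    ‖Complex.exp (Complex.exp (x + y * Complex.I) + (θ + 1) * (x + y * Complex.I))‖ ≤
      (1 + 24 / (-Real.cos φ) ^ 4) * Real.exp (-1 * |x|) := by
  have hp := Real.pi_pos
  have hk : 0 < -Real.cos φ := by
    have := Real.cos_neg_of_pi_div_two_lt_of_lt hφ1 (by linarith)
    linarith
  have hcos : Real.cos y ≤ Real.cos φ :=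
    Real.cos_le_cos_of_nonneg_of_le_pi (by linarith) hy2 hy1
  rw [Complex.norm_exp]
  have hre : (Complex.exp (x + y * Complex.I) + (θ + 1) * (x + y * Complex.I)).re =
      Real.exp x * Real.cos y + (θ + 1) * x := by
    simp [Complex.exp_re]
  rw [hre]
  set k := -Real.cos φ with hkdef
  have hex := Real.exp_pos x
  have h1 : Real.exp x * Real.cos y ≤ - (k * Real.exp x) := by nlinarith
  have hK : 0 < 24 / k ^ 4 := by positivity
  have hE := Real.exp_pos (-1 * |x|)
  rcases le_total x 0 with hx | hx
  · have h2 : Real.exp (Real.exp x * Real.cos y + (θ + 1) * x) ≤ Real.exp (-1 * |x|) := by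
      rw [Real.exp_le_exp, abs_of_nonpos hx]
      have : 0 < k * Real.exp x := by positivity
      nlinarith
    nlinarith
  · have h3 := Real.pow_div_factorial_le_exp (k * Real.exp x) (by positivity) 4
    have h4 : Real.exp (-(k * Real.exp x)) ≤ 24 / k ^ 4 * Real.exp (-4 * x) := by
      rw [Real.exp_neg]
      have : 24 / k ^ 4 * Real.exp (-4 * x) = ((k * Real.exp x) ^ 4 / (Nat.factorial 4 : ℕ))⁻¹ := by
        rw [mul_pow, ← Real.exp_nat_mul, show (-4 * x) = -((4:ℕ) * x) by push_cast; ring,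
          Real.exp_neg]
        norm_num [Nat.factorial]
        field_simp
      rw [this]
      exact inv_anti₀ (by positivity) h3
    calc Real.exp (Real.exp x * Real.cos y + (θ + 1) * x)
        ≤ Real.exp (-(k * Real.exp x) + 3 * x) := by
          rw [Real.exp_le_exp]; nlinarith
      _ = Real.exp (-(k * Real.exp x)) * Real.exp (3 * x) := Real.exp_add _ _
      _ ≤ 24 / k ^ 4 * Real.exp (-4 * x) * Real.exp (3 * x) := by gcongr
      _ = 24 / k ^ 4 * Real.exp (-1 * |x|) := by
          rw [mul_assoc, ← Real.exp_add, abs_of_nonneg hx]; ring_nf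
      _ ≤ _ := by nlinarith

lemma hank_integral (θ φ : ℝ) (hθ1 : 1 < θ) (hθ2 : θ < 2)
    (hφ1 : Real.pi / 2 < φ) (hφ2 : φ ≤ Real.pi) :
    ∫ t in Set.Ioi (0:ℝ), hankFun θ φ t =
      Complex.exp ((((θ + 1) * Real.pi : ℝ) : ℂ) * Complex.I) * (Real.Gamma (θ + 1) : ℂ) := by
  have h1 : ∫ t in Set.Ioi (0:ℝ), hankFun θ φ t = ∫ t in Set.Ioi (0:ℝ), hankFun θ Real.pi t := by
    rw [integral_log_sub, integral_log_sub]
    simp only [← hankFun_eq]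
    exact shift_integral
      (fun w => Complex.exp (Complex.exp w + (θ + 1) * w)) φ Real.pi _ 1 hφ2 one_pos
      (fun x y _ _ => by fun_prop)
      (fun x y h1 h2 => hank_bound θ φ x y hθ1 hθ2 hφ1 h1 h2)
  rw [h1, Real.Gamma_eq_integral (by linarith), ← integral_complex_ofReal, ← integral_const_mul]
  refine setIntegral_congr_fun measurableSet_Ioi (fun t ht => ?_)
  unfold hankFun
  simp only [Complex.exp_pi_mul_I, add_sub_cancel_right]
  push_cast
  ring_nf

lemma hank_integrable (θ φ : ℝ) (hθ1 : 1 < θ) (hθ2 : θ < 2)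
    (hφ1 : Real.pi / 2 < φ) (hφ2 : φ ≤ Real.pi) :
    IntegrableOn (hankFun θ φ) (Set.Ioi 0) := by
  rw [integrableOn_log_sub]
  simp only [← hankFun_eq]
  exact shift_integrable
      (fun w => Complex.exp (Complex.exp w + (θ + 1) * w)) φ _ 1 one_pos
      (fun x => by fun_prop)
      (fun x => hank_bound θ φ x φ hθ1 hθ2 hφ1 le_rfl hφ2)

/-- regularised Hankel integral -/
noncomputable def hankReg (θ φ ε : ℝ) : ℂ :=
  ∫ t in Set.Ioi (0:ℝ), hankFun θ φ t /
    (((ε * t ^ θ : ℝ) : ℂ) * Complex.exp (((θ * φ : ℝ) : ℂ) * Complex.I) + 1)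

lemma hankReg_tendsto (θ φ : ℝ) (hθ1 : 1 < θ) (hθ2 : θ < 2)
    (hφ1 : Real.pi / 2 < φ) (hφ2 : θ * φ < Real.pi) :
    Tendsto (hankReg θ φ) (𝓝[>] 0) (𝓝 (∫ t in Set.Ioi (0:ℝ), hankFun θ φ t)) := by
  have hp := Real.pi_pos
  have hδ : 0 < Real.sin (θ * φ) := Real.sin_pos_of_pos_of_lt_pi (by nlinarith) hφ2
  have hφπ : φ ≤ Real.pi := by nlinarith
  unfold hankReg
  refine tendsto_integral_filter_of_dominated_convergence
    (fun t => ‖hankFun θ φ t‖ / Real.sin (θ * φ)) ?_ ?_ ?_ ?_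
  · refine Eventually.of_forall fun ε => Measurable.aestronglyMeasurable ?_
    unfold hankFun
    fun_prop
  · filter_upwards [self_mem_nhdsWithin] with ε hε
    refine (ae_restrict_iff' measurableSet_Ioi).mpr (ae_of_all _ fun t ht => ?_)
    have ht' : 0 < t := ht
    have hε' : 0 < ε := hε
    rw [norm_div]
    have := (norm_lower (ε * t ^ θ) (θ * φ) _ (by positivity) le_rfl).1
    gcongr
  · exact (hank_integrable θ φ hθ1 hθ2 hφ1 hφπ).norm.div_const _
  · refine ae_of_all _ fun t => ?_
    have h1 : Tendsto (fun ε : ℝ =>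
        ((ε * t ^ θ : ℝ) : ℂ) * Complex.exp (((θ * φ : ℝ) : ℂ) * Complex.I) + 1)
        (𝓝[>] 0) (𝓝 1) := by
      have h2 : Continuous (fun ε : ℝ =>
        ((ε * t ^ θ : ℝ) : ℂ) * Complex.exp (((θ * φ : ℝ) : ℂ) * Complex.I) + 1) := by fun_prop
      have h3 := (h2.tendsto 0).mono_left (nhdsWithin_le_nhds (s := Set.Ioi 0))
      simpa using h3
    have h4 := (tendsto_const_nhds (x := hankFun θ φ t)).div h1 one_ne_zero
    rw [div_one] at h4
    exact h4

lemma ray_im (ε θ φ : ℝ) (hε : 0 < ε) (hθ1 : 1 < θ) (hθ2 : θ < 2)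
    (hφ1 : Real.pi / 2 < φ) (hφ2 : θ * φ < Real.pi) :
    (∫ t in Set.Ioi (0:ℝ), rayFun ε θ 1 φ t).im = -(ε * (hankReg θ φ ε).im) := by
  have hp := Real.pi_pos
  have hδ : 0 < Real.sin (θ * φ) := Real.sin_pos_of_pos_of_lt_pi (by nlinarith) hφ2
  have hφπ : φ ≤ Real.pi := by nlinarith
  have hre : (Complex.exp (φ * Complex.I)).re < 0 := by
    rw [Complex.exp_ofReal_mul_I_re]
    exact Real.cos_neg_of_pi_div_two_lt_of_lt hφ1 (by linarith)
  have i1 := integrableOn_exp_mul_complex_Ioi hre 0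
  have i2 := integral_exp_mul_complex_Ioi hre 0
  have i3 := ray_integrable ε θ φ 1 φ hε hθ1 hθ2 zero_le_one hφ1.le hφ2 hφ1.le le_rfl
  have key : (ε : ℂ) * hankReg θ φ ε =
      ∫ t in Set.Ioi (0:ℝ), (Complex.exp (φ * Complex.I) *
        Complex.exp (Complex.exp (φ * Complex.I) * t) - rayFun ε θ 1 φ t) := by
    unfold hankReg
    rw [← integral_const_mul]
    refine setIntegral_congr_fun measurableSet_Ioi (fun t ht => ?_)
    have ht' : 0 < t := ht
    have hn := (norm_lower (ε * t ^ θ) (θ * φ) _ (by positivity) le_rfl).1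
    have hne : ((ε * t ^ θ : ℝ) : ℂ) * Complex.exp (((θ * φ : ℝ) : ℂ) * Complex.I) + 1 ≠ 0 := by
      rw [← norm_pos_iff]; linarith
    simp only [rayFun, hankFun]
    rw [eq_sub_iff_add_eq, mul_div_assoc', ← add_div, div_eq_iff hne]
    have e1 : Complex.exp ((((θ + 1) * φ : ℝ) : ℂ) * Complex.I) =
        Complex.exp (((θ * φ : ℝ) : ℂ) * Complex.I) * Complex.exp (φ * Complex.I) := by
      rw [← Complex.exp_add]; push_cast; ring_nf
    rw [e1, mul_comm (Complex.exp (φ * Complex.I)) (t : ℂ)]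
    push_cast
    rw [one_mul]
    ring
  rw [integral_sub (i1.const_mul _) i3, integral_const_mul, i2] at key
  have k2 : Complex.exp (φ * Complex.I) * (-Complex.exp (Complex.exp (φ * Complex.I) * (0:ℝ)) /
      Complex.exp (φ * Complex.I)) = -1 := by
    rw [mul_div_cancel₀ _ (Complex.exp_ne_zero _)]
    simp
  rw [k2] at key
  have k3 := congrArg Complex.im key
  rw [Complex.im_ofReal_mul] at k3
  rw [k3]
  simp

lemma ray_scale (c θ φ r : ℝ) (hr : 0 < r) :
    ∫ t in Set.Ioi (0:ℝ), rayFun c θ r φ t =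
      (r⁻¹ : ℝ) • ∫ t in Set.Ioi (0:ℝ), rayFun (c * r ^ (-θ)) θ 1 φ t := by
  have := integral_comp_mul_left_Ioi (rayFun (c * r ^ (-θ)) θ 1 φ) 0 hr
  rw [mul_zero] at this
  rw [← this]
  refine setIntegral_congr_fun measurableSet_Ioi (fun t ht => ?_)
  have ht' : 0 < t := ht
  have e : c * r ^ (-θ) * (r * t) ^ θ = c * t ^ θ := by
    rw [Real.mul_rpow hr.le ht'.le, Real.rpow_neg hr.le]
    have : 0 < r ^ θ := by positivity
    field_simp
  simp only [rayFun, e]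
  push_cast
  rw [one_mul]

lemma FU_eq (c θ r : ℝ) (hc : 0 < c) (hθ1 : 1 < θ) (hθ2 : θ < 2) (hr : 0 < r) :
    FUfun c θ r = (1 / Real.pi) *
      (∫ t in Set.Ioi (0:ℝ), rayFun c θ r (Real.pi / 2) t).im := by
  have hp := Real.pi_pos
  have hlt : θ * (Real.pi / 2) < Real.pi := by nlinarith
  have hI := ray_integrable c θ (Real.pi / 2) r (Real.pi / 2) hc hθ1 hθ2 hr.le le_rfl hlt
    le_rfl le_rfl
  unfold FUfun
  set G : ℝ → ℂ := fun s => Complex.exp (Complex.I * r * s) /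
      ((c : ℂ) * Complex.exp (Complex.I * Real.sign s * θ * Real.pi / 2) *
        ((|s| ^ θ : ℝ) : ℂ) + 1) with hG
  have e1 : ∀ s ∈ Set.Ioi (0:ℝ), -Complex.I * rayFun c θ r (Real.pi / 2) s = G s := by
    intro s hs
    have hs' : 0 < s := hs
    have hi : Complex.exp (((Real.pi / 2 : ℝ) : ℂ) * Complex.I) = Complex.I := by
      push_cast; exact Complex.exp_pi_div_two_mul_I
    simp only [hG, rayFun, Real.sign_of_pos hs', abs_of_pos hs', hi]
    rw [mul_div_assoc']
    congr 1
    · rw [mul_comm (Complex.exp _) Complex.I, ← mul_assoc]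
      simp only [neg_mul, Complex.I_mul_I, neg_neg, one_mul]
      ring_nf
    · push_cast
      ring_nf
  have e2 : ∀ s ∈ Set.Ioi (0:ℝ), G (-s) = (starRingEnd ℂ) (G s) := by
    intro s hs
    have hs' : 0 < s := hs
    simp only [hG, Real.sign_of_pos hs', Real.sign_neg, abs_neg, abs_of_pos hs']
    rw [map_div₀, map_add, map_mul, map_mul, ← Complex.exp_conj, ← Complex.exp_conj]
    simp only [map_mul, map_div₀, Complex.conj_I, Complex.conj_ofReal, map_one, map_ofNat]
    push_cast
    ring_nf
  have g1 : IntegrableOn G (Set.Ioi 0) :=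
    IntegrableOn.congr_fun (hI.const_mul (-Complex.I)) e1 measurableSet_Ioi
  have g2' : IntegrableOn (fun s => G (-s)) (Set.Ioi 0) := by
    refine IntegrableOn.congr_fun (f := fun s => (starRingEnd ℂ) (G s)) ?_
      (fun s hs => (e2 s hs).symm) measurableSet_Ioi
    exact (Complex.conjCLE.toContinuousLinearMap.integrable_comp g1)
  have g2 : IntegrableOn G (Set.Iic 0) := by
    have h0 : IntegrableOn (fun s => G (-s)) (Set.Ici (-0)) := by
      rw [neg_zero, integrableOn_Ici_iff_integrableOn_Ioi]
      exact g2'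
    simpa using h0.comp_neg_Iic
  have hsplit : ∫ s : ℝ, G s = (∫ s in Set.Iic (0:ℝ), G s) + ∫ s in Set.Ioi (0:ℝ), G s :=
    (intervalIntegral.integral_Iic_add_Ioi g2 g1).symm
  have hneg : ∫ s in Set.Iic (0:ℝ), G s = (starRingEnd ℂ) (∫ s in Set.Ioi (0:ℝ), G s) := by
    have := integral_comp_neg_Ioi 0 G
    rw [neg_zero] at this
    rw [← this, ← integral_conj]
    exact setIntegral_congr_fun measurableSet_Ioi e2
  have hpos : ∫ s in Set.Ioi (0:ℝ), G s =
      -Complex.I * ∫ t in Set.Ioi (0:ℝ), rayFun c θ r (Real.pi / 2) t := by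
    rw [← integral_const_mul]
    exact (setIntegral_congr_fun measurableSet_Ioi e1).symm
  rw [hsplit, hneg, hpos]
  set A := ∫ t in Set.Ioi (0:ℝ), rayFun c θ r (Real.pi / 2) t
  have hc2 : (1 / (2 * (Real.pi : ℂ))) = ((1 / (2 * Real.pi) : ℝ) : ℂ) := by push_cast; rfl
  rw [hc2, Complex.re_ofReal_mul]
  simp
  field_simp
  ring

/-- `F_U(r) = (1+o(1))·(−c/Γ(−θ))·r^{−θ−1}` as `r → +∞`. -/
theorem stmt12 (c θ : ℝ) (hc : 0 < c) (hθ1 : 1 < θ) (hθ2 : θ < 2) :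
    Tendsto (fun r : ℝ => FUfun c θ r / ((-c / Real.Gamma (-θ)) * r ^ (-θ - 1)))
      atTop (𝓝 1) := by
  have hp := Real.pi_pos
  obtain ⟨φ, hφ1, hφ2⟩ : ∃ φ : ℝ, Real.pi / 2 < φ ∧ θ * φ < Real.pi := by
    refine ⟨Real.pi / 4 + Real.pi / (2 * θ), ?_, ?_⟩
    · have : Real.pi / 4 < Real.pi / (2 * θ) := by
        apply div_lt_div_of_pos_left hp (by linarith) (by linarith)
      linarith
    · have : θ * (Real.pi / 4 + Real.pi / (2 * θ)) = θ * Real.pi / 4 + Real.pi / 2 := by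
        field_simp
        try ring
      rw [this]
      nlinarith
  have hφπ : φ ≤ Real.pi := by nlinarith
  have hsin : Real.sin (Real.pi * θ) < 0 := by
    have : 0 < Real.sin (Real.pi * θ - Real.pi) :=
      Real.sin_pos_of_pos_of_lt_pi (by nlinarith) (by nlinarith)
    rw [Real.sin_sub_pi] at this
    linarith
  have hrefl := Real.Gamma_mul_Gamma_one_sub (-θ)
  rw [mul_neg, Real.sin_neg, show 1 - -θ = θ + 1 by ring] at hrefl
  have hG0 : Real.Gamma (-θ) ≠ 0 := by
    intro h
    rw [h, zero_mul] at hrefl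
    have : Real.pi / -Real.sin (Real.pi * θ) ≠ 0 := by
      exact div_ne_zero hp.ne' (neg_ne_zero.mpr hsin.ne)
    exact this hrefl.symm
  have hε : Tendsto (fun r : ℝ => c * r ^ (-θ)) atTop (𝓝[>] 0) := by
    refine tendsto_nhdsWithin_iff.mpr ⟨?_, ?_⟩
    · simpa using (tendsto_rpow_neg_atTop (by linarith : 0 < θ)).const_mul c
    · filter_upwards [eventually_gt_atTop 0] with r hr
      have : 0 < c * r ^ (-θ) := by positivity
      exact this
  have hlim := (hankReg_tendsto θ φ hθ1 hθ2 hφ1 hφ2).comp hε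
  rw [hank_integral θ φ hθ1 hθ2 hφ1 hφπ] at hlim
  have hlim2 := ((Complex.continuous_im.tendsto _).comp hlim).const_mul
    (Real.Gamma (-θ) / Real.pi)
  have hval : Real.Gamma (-θ) / Real.pi *
      (Complex.exp ((((θ + 1) * Real.pi : ℝ) : ℂ) * Complex.I) *
        (Real.Gamma (θ + 1) : ℂ)).im = 1 := by
    rw [Complex.im_mul_ofReal, Complex.exp_ofReal_mul_I_im,
      show (θ + 1) * Real.pi = Real.pi * θ + Real.pi by ring, Real.sin_add_pi]
    have h1 : Real.Gamma (-θ) / Real.pi * (-Real.sin (Real.pi * θ) * Real.Gamma (θ + 1)) =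
        (Real.Gamma (-θ) * Real.Gamma (θ + 1)) * (-Real.sin (Real.pi * θ)) / Real.pi := by ring
    rw [h1, hrefl]
    have := hsin.ne
    field_simp
  rw [hval] at hlim2
  refine hlim2.congr' ?_
  filter_upwards [eventually_gt_atTop 0] with r hr
  have hpos : 0 < c * r ^ (-θ) := by positivity
  rw [FU_eq c θ r hc hθ1 hθ2 hr, ray_rot c θ φ r hc hθ1 hθ2 hr.le hφ1.le hφ2,
    ray_scale c θ φ r hr, Complex.smul_im, ray_im _ θ φ hpos hθ1 hθ2 hφ1 hφ2,
    Real.rpow_sub_one hr.ne']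
  have hrp : r ^ (-θ) ≠ 0 := (Real.rpow_pos_of_pos hr _).ne'
  simp only [Function.comp, smul_eq_mul]
  field_simp
end

section
/- The integral ∫_0^∞ r^{1−θ/ν}·F_U(r)² dr is finite, and lim_{t→∞} t^{−θ/ν}·Σ_{k=1}^∞ (t·λ_k^{1/θ})²·F_U(t·λ_k^{1/θ})² = Λ^{1/ν}·(θ/ν)·∫_0^∞ r^{1−θ/ν}·F_U(r)² dr, where the limit is taken over integers t → ∞. -/
open Filter Topology MeasureTheory

lemma aux_integrableOn {E : Type*} [NormedAddCommGroup E] (f : ℝ → E) (C p : ℝ) (hp : 1 < p)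
    (hm : AEStronglyMeasurable f (volume.restrict (Set.Ioi 0)))
    (h1 : ∀ s, 0 < s → s ≤ 1 → ‖f s‖ ≤ C) (h2 : ∀ s, 1 < s → ‖f s‖ ≤ C * s ^ (-p)) :
    IntegrableOn f (Set.Ioi 0) := by
  have hU : Set.Ioi (0:ℝ) = Set.Ioc 0 1 ∪ Set.Ioi 1 :=
    (Set.Ioc_union_Ioi_eq_Ioi zero_le_one).symm
  rw [hU]
  refine IntegrableOn.union ?_ ?_
  · refine Integrable.mono' (g := fun _ => C) (by simp) ?_ ?_
    · exact hm.mono_measure (Measure.restrict_mono (fun x hx => hx.1) le_rfl)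
    · filter_upwards [ae_restrict_mem measurableSet_Ioc] with s hs using h1 s hs.1 hs.2
  · refine Integrable.mono' (g := fun s => C * s ^ (-p)) ?_ ?_ ?_
    · exact (integrableOn_Ioi_rpow_of_lt (by linarith) one_pos).const_mul C
    · exact hm.mono_measure (Measure.restrict_mono (Set.Ioi_subset_Ioi zero_le_one) le_rfl)
    · filter_upwards [ae_restrict_mem measurableSet_Ioi] with s hs using h2 s hs

lemma aux_lower (a : ℂ) (ha : a.im ≠ 0) :
    ∃ δ : ℝ, 0 < δ ∧ ∀ x : ℝ, 0 ≤ x → δ * (1 + x) ≤ ‖a * (x : ℂ) + 1‖ := by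
  have ha0 : 0 < ‖a‖ := by
    rw [norm_pos_iff]; rintro rfl; simp at ha
  have hm : 0 < |a.im| := abs_pos.mpr ha
  refine ⟨min (|a.im|) (|a.im| / ‖a‖) / 2, by positivity, fun x hx => ?_⟩
  have e1 : |a.im| * x ≤ ‖a * (x : ℂ) + 1‖ := by
    have := Complex.abs_im_le_norm (a * (x : ℂ) + 1)
    simpa [abs_mul, abs_of_nonneg hx] using this
  have e2 : |a.im| / ‖a‖ ≤ ‖a * (x : ℂ) + 1‖ := by
    rw [div_le_iff₀ ha0]
    have := Complex.abs_im_le_norm ((a * (x : ℂ) + 1) * (starRingEnd ℂ) a)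
    rw [norm_mul, RCLike.norm_conj] at this
    refine le_trans (le_of_eq ?_) this
    have : ((a * (x : ℂ) + 1) * (starRingEnd ℂ) a).im = - a.im := by
      simp; ring
    rw [this, abs_neg]
  have m1 := min_le_left (|a.im|) (|a.im| / ‖a‖)
  have m2 := min_le_right (|a.im|) (|a.im| / ‖a‖)
  nlinarith

noncomputable def JJ (a : ℂ) (θ r : ℝ) : ℂ :=
  ∫ s in Set.Ioi (0:ℝ), Complex.exp (Complex.I * r * s) / (a * ((s ^ θ : ℝ) : ℂ) + 1)

lemma aux_norm_exp (r s : ℝ) : ‖Complex.exp (Complex.I * r * s)‖ = 1 := by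
  rw [Complex.norm_exp]; simp

lemma aux_h_int (a : ℂ) (ha : a.im ≠ 0) (θ : ℝ) (hθ : 1 < θ) :
    IntegrableOn (fun s : ℝ => (a * ((s ^ θ : ℝ) : ℂ) + 1)⁻¹) (Set.Ioi 0) := by
  obtain ⟨δ, hδ, hlow⟩ := aux_lower a ha
  refine aux_integrableOn _ (1/δ) θ hθ (by apply Measurable.aestronglyMeasurable; fun_prop) ?_ ?_
  · intro s hs _
    rw [norm_inv, one_div]
    have hx : 0 ≤ s ^ θ := by positivity
    have := hlow _ hx
    gcongr
    nlinarith
  · intro s hs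
    have hs0 : 0 < s := by linarith
    have hx : 0 < s ^ θ := by positivity
    have := hlow _ hx.le
    rw [norm_inv, one_div, Real.rpow_neg hs0.le, ← mul_inv]
    gcongr
    nlinarith

lemma aux_exp_int (a : ℂ) (ha : a.im ≠ 0) (θ : ℝ) (hθ : 1 < θ) (r : ℝ) :
    IntegrableOn (fun s : ℝ => Complex.exp (Complex.I * r * s) / (a * ((s ^ θ : ℝ) : ℂ) + 1))
      (Set.Ioi 0) := by
  refine Integrable.mono (aux_h_int a ha θ hθ)
    (by apply Measurable.aestronglyMeasurable; fun_prop) ?_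
  filter_upwards with s
  rw [norm_div, aux_norm_exp, norm_inv, one_div]

lemma JJ_cont (a : ℂ) (ha : a.im ≠ 0) (θ : ℝ) (hθ : 1 < θ) : Continuous (JJ a θ) := by
  refine continuous_of_dominated (bound := fun s => ‖(a * ((s ^ θ : ℝ) : ℂ) + 1)⁻¹‖) ?_ ?_ ?_ ?_
  · intro r; exact (aux_exp_int a ha θ hθ r).aestronglyMeasurable
  · intro r
    filter_upwards with s
    rw [norm_div, aux_norm_exp, norm_inv, one_div]
  · exact (aux_h_int a ha θ hθ).norm
  · filter_upwards with s
    fun_prop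

lemma JJ_bdd (a : ℂ) (ha : a.im ≠ 0) (θ : ℝ) (hθ : 1 < θ) : ∃ C, ∀ r, ‖JJ a θ r‖ ≤ C := by
  refine ⟨∫ s in Set.Ioi (0:ℝ), ‖(a * ((s ^ θ : ℝ) : ℂ) + 1)⁻¹‖, fun r => ?_⟩
  refine norm_integral_le_of_norm_le (aux_h_int a ha θ hθ).norm ?_
  filter_upwards with s
  rw [norm_div, aux_norm_exp, norm_inv, one_div]

lemma JJ_decay (a : ℂ) (ha : a.im ≠ 0) (θ : ℝ) (hθ : 1 < θ) :
    ∃ C, ∀ r : ℝ, ‖(r : ℂ) * JJ a θ r‖ ≤ C := by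
  obtain ⟨δ, hδ, hlow⟩ := aux_lower a ha
  set u : ℝ → ℂ := fun s => (a * ((s ^ θ : ℝ) : ℂ) + 1)⁻¹ with hu
  set u' : ℝ → ℂ := fun s => -(a * ((θ * s ^ (θ - 1) : ℝ) : ℂ)) / (a * ((s ^ θ : ℝ) : ℂ) + 1) ^ 2
    with hu'
  have hne : ∀ s : ℝ, 0 < s → a * ((s ^ θ : ℝ) : ℂ) + 1 ≠ 0 := by
    intro s hs h0
    have hx : 0 < s ^ θ := by positivity
    have := hlow _ hx.le
    rw [h0, norm_zero] at this
    have : 0 < δ * (1 + s ^ θ) := by positivity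
    linarith
  have hder : ∀ s ∈ Set.Ioi (0:ℝ), HasDerivAt u (u' s) s := by
    intro s hs
    have h1 := (Real.hasDerivAt_rpow_const (x := s) (p := θ) (Or.inr hθ.le)).ofReal_comp
    exact ((h1.const_mul a).add_const 1).fun_inv (hne s hs)
  have hu'int : IntegrableOn u' (Set.Ioi 0) := by
    refine aux_integrableOn _ (‖a‖ * θ / δ ^ 2) (θ + 1) (by linarith)
      (by apply Measurable.aestronglyMeasurable; fun_prop) ?_ ?_
    · intro s hs hs1
      have hx : 0 < s ^ θ := by positivity
      have hl := hlow _ hx.le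
      have hy : 0 < s ^ (θ - 1) := by positivity
      have hy1 : s ^ (θ - 1) ≤ 1 := Real.rpow_le_one hs.le hs1 (by linarith)
      simp only [hu', norm_div, norm_neg, norm_mul, norm_pow, Complex.norm_real, Real.norm_eq_abs]
      rw [abs_of_pos (by linarith : 0 < θ), abs_of_pos hy]
      gcongr
      · exact mul_le_of_le_one_right (by linarith) hy1
      · nlinarith
    · intro s hs
      have hs0 : 0 < s := by linarith
      have hx : 0 < s ^ θ := by positivity
      have hl := hlow _ hx.le
      have hy : 0 < s ^ (θ - 1) := by positivity
      simp only [hu', norm_div, norm_neg, norm_mul, norm_pow, Complex.norm_real, Real.norm_eq_abs]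
      rw [abs_of_pos (by linarith : 0 < θ), abs_of_pos hy]
      have e : s ^ (-(θ + 1)) = s ^ (θ - 1) / (s ^ θ) ^ 2 := by
        rw [← Real.rpow_natCast, ← Real.rpow_mul hs0.le, ← Real.rpow_sub hs0]
        congr 1; push_cast; ring
      rw [e, div_mul_div_comm, ← mul_pow, mul_assoc ‖a‖]
      gcongr
      nlinarith
  refine ⟨1 + ∫ s in Set.Ioi (0:ℝ), ‖u' s‖, fun r => ?_⟩
  have hI0 : 0 ≤ ∫ s in Set.Ioi (0:ℝ), ‖u' s‖ := integral_nonneg (fun _ => norm_nonneg _)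
  rcases eq_or_ne r 0 with rfl | hr
  · simp; linarith
  have hIr : Complex.I * (r:ℂ) ≠ 0 := by simp [hr]
  set v : ℝ → ℂ := fun s => Complex.exp (Complex.I * r * s) / (Complex.I * r) with hv
  set v' : ℝ → ℂ := fun s => Complex.exp (Complex.I * r * s) with hv'
  have hvder : ∀ s ∈ Set.Ioi (0:ℝ), HasDerivAt v (v' s) s := by
    intro s _
    have h1 : HasDerivAt (fun s : ℝ => Complex.I * r * (s:ℂ)) (Complex.I * r) s := by
      simpa using (Complex.ofRealCLM.hasDerivAt (x := s)).const_mul (Complex.I * r)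
    have h2 := h1.cexp.div_const (Complex.I * r)
    simpa [hv, hv', hIr] using h2
  have hvn : ∀ s, ‖v s‖ = |r|⁻¹ := by
    intro s; simp only [hv, norm_div, aux_norm_exp]; simp
  have huv' : u * v' = fun s : ℝ =>
      Complex.exp (Complex.I * r * s) / (a * ((s ^ θ : ℝ) : ℂ) + 1) := by
    funext s; simp only [Pi.mul_apply, hu, hv']; field_simp
  have hint1 : IntegrableOn (u * v') (Set.Ioi 0) := by
    rw [huv']; exact aux_exp_int a ha θ hθ r
  have hvm : Measurable v := by fun_prop
  have hint2 : IntegrableOn (u' * v) (Set.Ioi 0) := by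
    refine Integrable.mono' (hu'int.norm.mul_const |r|⁻¹)
      (hu'int.aestronglyMeasurable.mul hvm.aestronglyMeasurable) ?_
    filter_upwards with s
    simp only [Pi.mul_apply, norm_mul, hvn]; exact le_rfl
  have hθ0 : θ ≠ 0 := by linarith
  have hucont : ContinuousAt u 0 := by
    have h1 : ContinuousAt (fun s : ℝ => s ^ θ) 0 :=
      Real.continuousAt_rpow_const _ _ (Or.inr (by linarith))
    refine ContinuousAt.inv₀ (by fun_prop) ?_
    simp [Real.zero_rpow hθ0]
  have hvcont : Continuous v := by fun_prop
  have hl0 : Tendsto (u * v) (𝓝[>] 0) (𝓝 (1 / (Complex.I * r))) := by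
    have h := (hucont.mul hvcont.continuousAt).tendsto.mono_left
      (nhdsWithin_le_nhds (s := Set.Ioi (0:ℝ)))
    have e : u 0 * v 0 = 1 / (Complex.I * r) := by
      simp [hu, hv, Real.zero_rpow hθ0]
    rw [← e]; exact h
  have hl1 : Tendsto (u * v) atTop (𝓝 0) := by
    rw [tendsto_zero_iff_norm_tendsto_zero]
    have hT : Tendsto (fun s : ℝ => (δ⁻¹ * |r|⁻¹) * s ^ (-θ)) atTop (𝓝 0) := by
      simpa using (tendsto_rpow_neg_atTop (by linarith : 0 < θ)).const_mul (δ⁻¹ * |r|⁻¹)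
    refine squeeze_zero' (Eventually.of_forall fun _ => norm_nonneg _) ?_ hT
    filter_upwards [eventually_gt_atTop 0] with s hs
    have hx : 0 < s ^ θ := by positivity
    have hl := hlow _ hx.le
    simp only [Pi.mul_apply, norm_mul, hvn, hu, norm_inv]
    rw [Real.rpow_neg hs.le, mul_right_comm, ← mul_inv δ]
    refine mul_le_mul_of_nonneg_right ?_ (by positivity)
    apply inv_anti₀ (by positivity)
    nlinarith
  have key := integral_Ioi_mul_deriv_eq_deriv_mul hder hvder hint1 hint2 hl0 hl1
  have hJ : JJ a θ r = 0 - 1 / (Complex.I * r) - ∫ s in Set.Ioi (0:ℝ), u' s * v s := by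
    rw [← key]; unfold JJ
    congr 1; exact huv'.symm
  have hb : ‖∫ s in Set.Ioi (0:ℝ), u' s * v s‖ ≤ (∫ s in Set.Ioi (0:ℝ), ‖u' s‖) * |r|⁻¹ := by
    rw [← integral_mul_const]
    refine norm_integral_le_of_norm_le (hu'int.norm.mul_const _) ?_
    filter_upwards with s
    rw [norm_mul, hvn]
  have hn : ‖JJ a θ r‖ ≤ |r|⁻¹ + (∫ s in Set.Ioi (0:ℝ), ‖u' s‖) * |r|⁻¹ := by
    rw [hJ]
    refine (norm_sub_le _ _).trans (add_le_add ?_ hb)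
    simp
  have hr0 : 0 < |r| := abs_pos.mpr hr
  rw [norm_mul, Complex.norm_real, Real.norm_eq_abs]
  calc |r| * ‖JJ a θ r‖ ≤ |r| * (|r|⁻¹ + (∫ s in Set.Ioi (0:ℝ), ‖u' s‖) * |r|⁻¹) := by gcongr
    _ = _ := by field_simp

lemma FU_eq_s13 (c θ : ℝ) (hc : 0 < c) (hθ1 : 1 < θ) (hθ2 : θ < 2) :
    ∃ a b : ℂ, a.im ≠ 0 ∧ b.im ≠ 0 ∧ ∀ r, FUfun c θ r =
      ((1 / (2 * Real.pi)) * (JJ b θ (-r) + JJ a θ r)).re := by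
  have hsin : 0 < Real.sin (θ * Real.pi / 2) := by
    apply Real.sin_pos_of_pos_of_lt_pi
    · have := Real.pi_pos; positivity
    · nlinarith [Real.pi_pos]
  have ha : ((c : ℂ) * Complex.exp (Complex.I * θ * Real.pi / 2)).im ≠ 0 := by
    have : Complex.I * θ * Real.pi / 2 = ((θ * Real.pi / 2 : ℝ) : ℂ) * Complex.I := by
      push_cast; ring
    rw [this, Complex.im_ofReal_mul, Complex.exp_ofReal_mul_I_im]
    positivity
  have hb : ((c : ℂ) * Complex.exp (-(Complex.I * θ * Real.pi / 2))).im ≠ 0 := by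
    have : -(Complex.I * θ * Real.pi / 2) = ((-(θ * Real.pi / 2) : ℝ) : ℂ) * Complex.I := by
      push_cast; ring
    rw [this, Complex.im_ofReal_mul, Complex.exp_ofReal_mul_I_im, Real.sin_neg]
    have : 0 < c * Real.sin (θ * Real.pi / 2) := by positivity
    intro h; linarith
  refine ⟨_, _, ha, hb, fun r => ?_⟩
  unfold FUfun
  congr 2
  set f : ℝ → ℂ := fun s => Complex.exp (Complex.I * r * s) /
      ((c : ℂ) * Complex.exp (Complex.I * Real.sign s * θ * Real.pi / 2) *
        ((|s| ^ θ : ℝ) : ℂ) + 1) with hf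
  have hp : Set.EqOn f (fun s : ℝ => Complex.exp (Complex.I * r * s) /
      ((c : ℂ) * Complex.exp (Complex.I * θ * Real.pi / 2) * ((s ^ θ : ℝ) : ℂ) + 1))
      (Set.Ioi 0) := by
    intro s hs
    have hs : 0 < s := hs
    simp [hf, Real.sign_of_pos hs, abs_of_pos hs]
  have hn : Set.EqOn (fun s => f (-s)) (fun s : ℝ => Complex.exp (Complex.I * (-r : ℝ) * s) /
      ((c : ℂ) * Complex.exp (-(Complex.I * θ * Real.pi / 2)) * ((s ^ θ : ℝ) : ℂ) + 1))
      (Set.Ioi 0) := by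
    intro s hs
    have hs : 0 < s := hs
    simp [hf, Real.sign_of_neg (neg_lt_zero.mpr hs), abs_of_pos hs, neg_div]
  have i1 : IntegrableOn f (Set.Ioi 0) :=
    (integrableOn_congr_fun hp measurableSet_Ioi).mpr (aux_exp_int _ ha θ hθ1 r)
  have i2 : IntegrableOn (fun s => f (-s)) (Set.Ioi 0) :=
    (integrableOn_congr_fun hn measurableSet_Ioi).mpr (aux_exp_int _ hb θ hθ1 (-r))
  have i3 : IntegrableOn f (Set.Iic 0) := by
    have := IntegrableOn.comp_neg_Iic (c := (0:ℝ)) (f := fun s => f (-s))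
      (by rw [neg_zero]; exact (integrableOn_Ici_iff_integrableOn_Ioi (by simp)).mpr i2)
    simpa using this
  rw [← intervalIntegral.integral_Iic_add_Ioi i3 i1]
  congr 1
  · have := integral_comp_neg_Ioi 0 f
    rw [neg_zero] at this
    rw [← this]
    exact setIntegral_congr_fun measurableSet_Ioi hn
  · exact setIntegral_congr_fun measurableSet_Ioi hp

lemma FU_cont (c θ : ℝ) (hc : 0 < c) (hθ1 : 1 < θ) (hθ2 : θ < 2) : Continuous (FUfun c θ) := by
  obtain ⟨a, b, ha, hb, h⟩ := FU_eq_s13 c θ hc hθ1 hθ2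
  rw [funext h]
  have h1 := JJ_cont a ha θ hθ1
  have h2 := JJ_cont b hb θ hθ1
  fun_prop

lemma FU_bound (c θ : ℝ) (hc : 0 < c) (hθ1 : 1 < θ) (hθ2 : θ < 2) :
    ∃ C, 0 ≤ C ∧ ∀ r, |FUfun c θ r| ≤ C ∧ |r * FUfun c θ r| ≤ C := by
  obtain ⟨a, b, ha, hb, h⟩ := FU_eq_s13 c θ hc hθ1 hθ2
  obtain ⟨A, hA⟩ := JJ_bdd a ha θ hθ1
  obtain ⟨B, hB⟩ := JJ_bdd b hb θ hθ1
  obtain ⟨A', hA'⟩ := JJ_decay a ha θ hθ1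
  obtain ⟨B', hB'⟩ := JJ_decay b hb θ hθ1
  have hk : ‖(1 / (2 * Real.pi) : ℂ)‖ = 1 / (2 * Real.pi) := by
    simp [abs_of_pos Real.pi_pos]
  have hpi := Real.pi_pos
  have hkk : 0 < 1 / (2 * Real.pi) := by positivity
  have e1 : ∀ r, |FUfun c θ r| ≤ 1 / (2 * Real.pi) * (‖JJ b θ (-r)‖ + ‖JJ a θ r‖) := by
    intro r
    rw [h r]
    refine (Complex.abs_re_le_norm _).trans ?_
    rw [norm_mul, hk]
    gcongr
    exact norm_add_le _ _
  refine ⟨max (1 / (2 * Real.pi) * (B + A)) (1 / (2 * Real.pi) * (B' + A')), ?_, fun r => ⟨?_, ?_⟩⟩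
  · have := (norm_nonneg _).trans (hA 0)
    have := (norm_nonneg _).trans (hB 0)
    exact le_max_of_le_left (by positivity)
  · refine le_max_of_le_left ((e1 r).trans ?_)
    gcongr
    · exact hB _
    · exact hA _
  · refine le_max_of_le_right ?_
    rw [abs_mul]
    refine (mul_le_mul_of_nonneg_left (e1 r) (abs_nonneg r)).trans ?_
    have h1 := hA' r
    have h2 := hB' (-r)
    rw [norm_mul, Complex.norm_real, Real.norm_eq_abs] at h1 h2
    rw [abs_neg] at h2
    rw [mul_left_comm, mul_add]
    gcongr

lemma aux_floor_sum (f : ℕ → ℝ) (hf : IntegrableOn (fun u : ℝ => f ⌊u⌋₊) (Set.Ioi 0)) :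
    ∫ u in Set.Ioi (0:ℝ), f ⌊u⌋₊ = ∑' k, f k := by
  have hU : (⋃ k : ℕ, Set.Ico (k:ℝ) (k+1)) = Set.Ici 0 := by
    ext x
    simp only [Set.mem_iUnion, Set.mem_Ico, Set.mem_Ici]
    constructor
    · rintro ⟨k, hk, _⟩
      exact (Nat.cast_nonneg k).trans hk
    · intro hx
      exact ⟨⌊x⌋₊, Nat.floor_le hx, Nat.lt_floor_add_one x⟩
  have hfl : ∀ k : ℕ, ∀ x ∈ Set.Ico (k:ℝ) (k+1), ⌊x⌋₊ = k := by
    intro k x hx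
    exact (Nat.floor_eq_iff ((Nat.cast_nonneg k).trans hx.1)).mpr hx
  have hd : Pairwise (Function.onFun Disjoint (fun k : ℕ => Set.Ico (k:ℝ) (k+1))) := by
    intro i j hij
    rw [Function.onFun, Set.disjoint_left]
    intro x hi hj
    exact hij ((hfl i x hi).symm.trans (hfl j x hj))
  have hint : IntegrableOn (fun u : ℝ => f ⌊u⌋₊) (⋃ k : ℕ, Set.Ico (k:ℝ) (k+1)) := by
    rw [hU]
    exact (integrableOn_Ici_iff_integrableOn_Ioi (by simp)).mpr hf
  have h := integral_iUnion (fun k : ℕ => measurableSet_Ico) hd hint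
  rw [hU, integral_Ici_eq_integral_Ioi] at h
  rw [h]
  refine tsum_congr fun k => ?_
  rw [setIntegral_congr_fun (g := fun _ => f k) measurableSet_Ico
    (fun x hx => by simp only [hfl k x hx])]
  simp

lemma aux_main (G : ℝ → ℝ) (K : ℝ) (hG : Continuous G) (hK0 : 0 ≤ K) (h1 : ∀ x, |G x| ≤ K)
    (h2 : ∀ x, |G x| ≤ K * x ^ 2)
    (θ : ℝ) (hθ1 : 1 < θ) (hθ2 : θ < 2)
    (Λ ν : ℝ) (hΛ : 0 < Λ) (hν : 1 < ν)
    (lam : ℕ → ℝ) (hpos : ∀ k, 0 < lam k)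
    (hasymp : Tendsto (fun k : ℕ => lam k * ((k : ℝ) + 1) ^ ν) atTop (𝓝 Λ)) :
    Tendsto (fun t : ℕ => (t : ℝ) ^ (-(θ / ν)) * ∑' k : ℕ, G ((t : ℝ) * (lam k) ^ (1 / θ))) atTop
      (𝓝 (∫ u in Set.Ioi (0 : ℝ), G (Λ ^ (1 / θ) * u ^ (-(ν / θ))))) := by
  have hθ0 : 0 < θ := by linarith
  have hν0 : 0 < ν := by linarith
  have hα : 0 < θ / ν := by positivity
  obtain ⟨M, hM⟩ := hasymp.bddAbove_range
  have hM : ∀ k : ℕ, lam k * ((k : ℝ) + 1) ^ ν ≤ M := fun k => hM ⟨k, rfl⟩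
  have hM0 : 0 < M := lt_of_lt_of_le (mul_pos (hpos 0) (by positivity)) (hM 0)
  have hid : ∀ (t : ℕ), 0 < t → ∀ k : ℕ, (t : ℝ) * (lam k) ^ (1 / θ) =
      (lam k * ((k : ℝ) + 1) ^ ν) ^ (1 / θ) * (((k : ℝ) + 1) / (t : ℝ) ^ (θ / ν)) ^ (-(ν / θ)) := by
    intro t ht k
    have ht : (0:ℝ) < t := by exact_mod_cast ht
    have hk : (0:ℝ) < (k:ℝ) + 1 := by positivity
    rw [Real.mul_rpow (hpos k).le (by positivity), ← Real.rpow_mul hk.le,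
      Real.div_rpow hk.le (by positivity), ← Real.rpow_mul ht.le, Real.rpow_neg hk.le]
    have e1 : θ / ν * -(ν / θ) = -1 := by field_simp
    have e2 : ν * (1 / θ) = ν / θ := by ring
    rw [e1, e2, Real.rpow_neg_one]
    have : ((k:ℝ) + 1) ^ (ν / θ) ≠ 0 := by positivity
    field_simp
  set Φ : ℕ → ℝ → ℝ := fun t u => G ((t : ℝ) * (lam ⌊u * (t:ℝ) ^ (θ / ν)⌋₊) ^ (1 / θ)) with hΦ
  have hmeas : ∀ t, Measurable (Φ t) := by
    intro t
    have hm : Measurable (fun k : ℕ => G ((t : ℝ) * (lam k) ^ (1 / θ))) := measurable_from_nat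
    exact hm.comp (Nat.measurable_floor.comp (measurable_id.mul_const _))
  set N := K * (1 + (M ^ (1 / θ)) ^ 2) with hN
  set bd : ℝ → ℝ := fun u => min N (N * u ^ (-(2 * (ν / θ)))) with hbd
  have hN0 : 0 ≤ N := by positivity
  have hp : 1 < 2 * (ν / θ) := by
    rw [mul_div_assoc', lt_div_iff₀ hθ0]; linarith
  have hbdint : IntegrableOn bd (Set.Ioi 0) := by
    refine aux_integrableOn _ N (2 * (ν / θ)) hp
      (by apply Measurable.aestronglyMeasurable; fun_prop) ?_ ?_
    · intro s hs _
      rw [Real.norm_eq_abs, abs_of_nonneg (by simp only [hbd]; positivity)]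
      exact min_le_left _ _
    · intro s hs
      have hs : 0 < s := by linarith
      rw [Real.norm_eq_abs, abs_of_nonneg (by simp only [hbd]; positivity)]
      exact min_le_right _ _
  have hbound : ∀ t : ℕ, 0 < t → ∀ u ∈ Set.Ioi (0:ℝ), ‖Φ t u‖ ≤ bd u := by
    intro t ht u hu
    have hu : 0 < u := hu
    have htr : (0:ℝ) < t := by exact_mod_cast ht
    have hT : 0 < (t:ℝ) ^ (θ / ν) := by positivity
    rw [Real.norm_eq_abs]
    refine le_min ((h1 _).trans ?_) ((h2 _).trans ?_)
    · rw [hN]; nlinarith [mul_nonneg hK0 (sq_nonneg (M ^ (1 / θ)))]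
    · rw [hid t ht]
      set k := ⌊u * (t:ℝ) ^ (θ / ν)⌋₊ with hk
      have hku : u ≤ ((k:ℝ) + 1) / (t:ℝ) ^ (θ / ν) := by
        rw [le_div_iff₀ hT]; exact (Nat.lt_floor_add_one _).le
      have a1 : (((k:ℝ) + 1) / (t:ℝ) ^ (θ / ν)) ^ (-(ν / θ)) ≤ u ^ (-(ν / θ)) := by
        apply Real.rpow_le_rpow_of_nonpos hu hku
        have : 0 < ν / θ := by positivity
        linarith
      have hlk := hpos k
      have a2 : (lam k * ((k : ℝ) + 1) ^ ν) ^ (1 / θ) ≤ M ^ (1 / θ) :=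
        Real.rpow_le_rpow (by positivity) (hM k) (by positivity)
      have e : u ^ (-(2 * (ν / θ))) = (u ^ (-(ν / θ))) ^ 2 := by
        rw [← Real.rpow_natCast, ← Real.rpow_mul hu.le]
        congr 1; push_cast; ring
      rw [e]
      calc K * ((lam k * ((k : ℝ) + 1) ^ ν) ^ (1 / θ) *
            (((k:ℝ) + 1) / (t:ℝ) ^ (θ / ν)) ^ (-(ν / θ))) ^ 2
          ≤ K * (M ^ (1 / θ) * u ^ (-(ν / θ))) ^ 2 := by gcongr
        _ = K * (M ^ (1 / θ)) ^ 2 * (u ^ (-(ν / θ))) ^ 2 := by ring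
        _ ≤ N * (u ^ (-(ν / θ))) ^ 2 := by
          rw [hN]; gcongr; linarith
  have hTt : Tendsto (fun t : ℕ => (t:ℝ) ^ (θ / ν)) atTop atTop :=
    (tendsto_rpow_atTop hα).comp tendsto_natCast_atTop_atTop
  have hlim : ∀ u ∈ Set.Ioi (0:ℝ), Tendsto (fun t => Φ t u) atTop
      (𝓝 (G (Λ ^ (1 / θ) * u ^ (-(ν / θ))))) := by
    intro u hu
    have hu : 0 < u := hu
    have hk : Tendsto (fun t : ℕ => ⌊u * (t:ℝ) ^ (θ / ν)⌋₊) atTop atTop :=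
      tendsto_nat_floor_atTop.comp (hTt.const_mul_atTop hu)
    have l1 := (hasymp.comp hk).rpow_const (p := 1 / θ) (Or.inl hΛ.ne')
    have l2 : Tendsto (fun t : ℕ => ((⌊u * (t:ℝ) ^ (θ / ν)⌋₊ : ℝ) + 1) / (t:ℝ) ^ (θ / ν))
        atTop (𝓝 u) := by
      have m1 := (tendsto_nat_floor_mul_div_atTop hu.le).comp hTt
      have m2 := tendsto_inv_atTop_zero.comp hTt
      have m3 := m1.add m2
      rw [add_zero] at m3
      refine m3.congr fun t => ?_
      simp only [Function.comp]
      rw [add_div, one_div]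
    have l3 := l2.rpow_const (p := -(ν / θ)) (Or.inl hu.ne')
    refine (hG.tendsto _).comp ((l1.mul l3).congr' ?_)
    filter_upwards [eventually_gt_atTop 0] with t ht
    rw [hid t ht]
    rfl
  have hmain : Tendsto (fun t => ∫ u in Set.Ioi (0:ℝ), Φ t u) atTop
      (𝓝 (∫ u in Set.Ioi (0 : ℝ), G (Λ ^ (1 / θ) * u ^ (-(ν / θ))))) := by
    refine tendsto_integral_filter_of_dominated_convergence bd ?_ ?_ hbdint ?_
    · exact Eventually.of_forall fun t => (hmeas t).aestronglyMeasurable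
    · filter_upwards [eventually_gt_atTop 0] with t ht
      filter_upwards [ae_restrict_mem measurableSet_Ioi] with u hu using hbound t ht u hu
    · filter_upwards [ae_restrict_mem measurableSet_Ioi] with u hu using hlim u hu
  refine hmain.congr' ?_
  filter_upwards [eventually_gt_atTop 0] with t ht
  have htr : (0:ℝ) < t := by exact_mod_cast ht
  have hT : 0 < (t:ℝ) ^ (θ / ν) := by positivity
  set f : ℕ → ℝ := fun k => G ((t : ℝ) * (lam k) ^ (1 / θ)) with hf
  have hint : IntegrableOn (Φ t) (Set.Ioi 0) := by
    refine Integrable.mono' hbdint (hmeas t).aestronglyMeasurable ?_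
    filter_upwards [ae_restrict_mem measurableSet_Ioi] with u hu using hbound t ht u hu
  have hint2 : IntegrableOn (fun u : ℝ => f ⌊u⌋₊) (Set.Ioi 0) := by
    have := (integrableOn_Ioi_comp_mul_right_iff (fun u : ℝ => f ⌊u⌋₊) 0 hT).mp hint
    simpa using this
  have := integral_comp_mul_right_Ioi (fun u : ℝ => f ⌊u⌋₊) 0 hT
  rw [zero_mul, aux_floor_sum f hint2, smul_eq_mul, ← Real.rpow_neg htr.le] at this
  exact this

theorem stmt13 (c θ : ℝ) (hc : 0 < c) (hθ1 : 1 < θ) (hθ2 : θ < 2)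
    (Λ ν : ℝ) (hΛ : 0 < Λ) (hν : 1 < ν)
    (lam : ℕ → ℝ) (hpos : ∀ k, 0 < lam k)
    (hasymp : Tendsto (fun k : ℕ => lam k * ((k : ℝ) + 1) ^ ν) atTop (𝓝 Λ)) :
    IntegrableOn (fun r : ℝ => r ^ (1 - θ / ν) * (FUfun c θ r) ^ 2) (Set.Ioi 0) ∧
    Tendsto (fun t : ℕ => (t : ℝ) ^ (-(θ / ν)) *
        ∑' k : ℕ, ((t : ℝ) * (lam k) ^ (1 / θ)) ^ 2 *
          (FUfun c θ ((t : ℝ) * (lam k) ^ (1 / θ))) ^ 2) atTop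
      (𝓝 (Λ ^ (1 / ν) * (θ / ν) *
        ∫ r in Set.Ioi (0 : ℝ), r ^ (1 - θ / ν) * (FUfun c θ r) ^ 2)) := by
  have hθ0 : 0 < θ := by linarith
  have hν0 : 0 < ν := by linarith
  have hα : 0 < θ / ν := by positivity
  have hcont := FU_cont c θ hc hθ1 hθ2
  obtain ⟨C, hC0, hC⟩ := FU_bound c θ hc hθ1 hθ2
  set G : ℝ → ℝ := fun x => x ^ 2 * (FUfun c θ x) ^ 2 with hGdef
  have hG : Continuous G := by fun_prop
  have b1 : ∀ x, |G x| ≤ C ^ 2 := by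
    intro x
    simp only [hGdef]
    rw [← mul_pow, abs_pow]
    exact pow_le_pow_left₀ (abs_nonneg _) (hC x).2 2
  have b2 : ∀ x, |G x| ≤ C ^ 2 * x ^ 2 := by
    intro x
    simp only [hGdef]
    rw [abs_mul, abs_of_nonneg (sq_nonneg x), abs_pow, mul_comm]
    exact mul_le_mul_of_nonneg_right (pow_le_pow_left₀ (abs_nonneg _) (hC x).1 2) (sq_nonneg x)
  set g0 : ℝ → ℝ := fun u => G (u ^ (-(ν / θ))) with hg0
  have hp : 1 < 2 * (ν / θ) := by
    rw [mul_div_assoc', lt_div_iff₀ hθ0]; linarith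
  have hg0int : IntegrableOn g0 (Set.Ioi 0) := by
    refine aux_integrableOn _ (C ^ 2) (2 * (ν / θ)) hp ?_ ?_ ?_
    · have : Measurable G := hG.measurable
      exact (this.comp (by fun_prop : Measurable fun u : ℝ => u ^ (-(ν / θ)))).aestronglyMeasurable
    · intro s _ _; exact b1 _
    · intro s hs
      have hs : 0 < s := by linarith
      have e : s ^ (-(2 * (ν / θ))) = (s ^ (-(ν / θ))) ^ 2 := by
        rw [← Real.rpow_natCast, ← Real.rpow_mul hs.le]
        congr 1; push_cast; ring
      rw [e]; exact b2 _
  have hneg : -(θ / ν) ≠ 0 := by linarith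
  have heq : Set.EqOn (fun x : ℝ => x ^ (-(θ / ν) - 1) • g0 (x ^ (-(θ / ν))))
      (fun r : ℝ => r ^ (1 - θ / ν) * (FUfun c θ r) ^ 2) (Set.Ioi 0) := by
    intro x hx
    have hx : 0 < x := hx
    have e : (x ^ (-(θ / ν))) ^ (-(ν / θ)) = x := by
      rw [← Real.rpow_mul hx.le]
      have : -(θ / ν) * -(ν / θ) = 1 := by field_simp
      rw [this, Real.rpow_one]
    have e2 : x ^ (1 - θ / ν) = x ^ (-(θ / ν) - 1) * x ^ 2 := by
      rw [← Real.rpow_natCast, ← Real.rpow_add hx]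
      congr 1; push_cast; ring
    simp only [hg0, hGdef, e, smul_eq_mul, e2]
    ring
  refine ⟨(integrableOn_congr_fun heq measurableSet_Ioi).mp
    ((integrableOn_Ioi_comp_rpow_iff' g0 hneg).mpr hg0int), ?_⟩
  have key := aux_main G (C ^ 2) hG (by positivity) b1 b2 θ hθ1 hθ2 Λ ν hΛ hν lam hpos hasymp
  have hI : ∫ u in Set.Ioi (0 : ℝ), G (Λ ^ (1 / θ) * u ^ (-(ν / θ))) = Λ ^ (1 / ν) * (θ / ν) *
        ∫ r in Set.Ioi (0 : ℝ), r ^ (1 - θ / ν) * (FUfun c θ r) ^ 2 := by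
    have s1 : ∫ u in Set.Ioi (0 : ℝ), G (Λ ^ (1 / θ) * u ^ (-(ν / θ))) =
        ∫ u in Set.Ioi (0 : ℝ), g0 (Λ ^ (-(1 / ν)) * u) := by
      refine setIntegral_congr_fun measurableSet_Ioi fun u hu => ?_
      have hu : 0 < u := hu
      simp only [hg0]
      rw [Real.mul_rpow (by positivity) hu.le, ← Real.rpow_mul hΛ.le]
      congr 4
      field_simp
    have s2 := integral_comp_mul_left_Ioi g0 0 (b := Λ ^ (-(1 / ν))) (by positivity)
    have s3 := integral_comp_rpow_Ioi g0 hneg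
    rw [s1, s2, mul_zero, ← s3, ← Real.rpow_neg hΛ.le, neg_neg, smul_eq_mul, mul_assoc]
    congr 1
    rw [← integral_const_mul]
    refine setIntegral_congr_fun measurableSet_Ioi fun x hx => ?_
    have := heq hx
    simp only [smul_eq_mul] at this ⊢
    rw [← this, abs_neg, abs_of_pos hα]
    ring
  rw [← hI]
  exact key
end
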